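/- Nonexistence of solar points: assume additionally closure(S) ≠ Y. Then for every y_d ∈ Y \ closure(S), every ȳ ∈ P(y_d), and every s ∈ ℝ with |s| > (Θ/(1 − Θ))^{1/2}·‖ȳ‖, one has ȳ ∉ P(ȳ + s·(y_d − ȳ)/‖y_d − ȳ‖). In particular, closure(S) admits no solar points: there exist no y_d ∈ Y \ closure(S) and ȳ ∈ P(y_d) such that ȳ ∈ P(ȳ + s·(y_d − ȳ)) for all s ∈ (0, ∞). -/

import Mathlib

open Filter Metric
open scoped InnerProductSpace

noncomputable section

/-- The optimal value of the squared loss `inf_{α ∈ D} ‖F α - y‖²`. -/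
def lossInf {Y : Type} [NormedAddCommGroup Y] {m : ℕ}
    (D : Set (Fin m → ℝ)) (F : (Fin m → ℝ) → Y) (y : Y) : ℝ :=
  sInf ((fun α => ‖F α - y‖ ^ 2) '' D)

/-- The worst-case error bound `Θ = sup_{‖y‖ = 1} inf_{α ∈ D} ‖F α - y‖²`. -/
def Theta {Y : Type} [NormedAddCommGroup Y] {m : ℕ}
    (D : Set (Fin m → ℝ)) (F : (Fin m → ℝ) → Y) : ℝ :=
  sSup ((fun y => lossInf D F y) '' {y : Y | ‖y‖ = 1})

/-- The set of best approximations of `y` in `closure (F '' D)`. -/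
def bestApprox {Y : Type} [NormedAddCommGroup Y] {m : ℕ}
    (D : Set (Fin m → ℝ)) (F : (Fin m → ℝ) → Y) (y : Y) : Set Y :=
  {z | z ∈ closure (F '' D) ∧ ‖z - y‖ = Metric.infDist y (closure (F '' D))}

section Cone

variable {Y : Type} [NormedAddCommGroup Y] {m : ℕ} {D : Set (Fin m → ℝ)} {F : (Fin m → ℝ) → Y}

theorem lossInf_eq_infDist_sq (hD : D.Nonempty) (y : Y) :
    lossInf D F y = infDist y (closure (F '' D)) ^ 2 := by
  rw [infDist_closure]
  have hbdd : BddBelow ((fun α => ‖F α - y‖ ^ 2) '' D) :=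
    ⟨0, by rintro _ ⟨α, -, rfl⟩; positivity⟩
  apply le_antisymm
  · refine (Real.sqrt_le_left infDist_nonneg).1 ?_
    refine le_of_forall_gt fun r hr => ?_
    obtain ⟨_, ⟨α, hα, rfl⟩, hlt⟩ := (infDist_lt_iff (hD.image F)).1 hr
    rw [dist_comm, dist_eq_norm] at hlt
    refine lt_of_le_of_lt ?_ hlt
    exact Real.sqrt_le_iff.2 ⟨norm_nonneg _, csInf_le hbdd ⟨α, hα, rfl⟩⟩
  · refine le_csInf (hD.image _) ?_
    rintro _ ⟨α, hα, rfl⟩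
    have h := infDist_le_dist_of_mem (x := y) (Set.mem_image_of_mem F hα)
    rw [dist_comm, dist_eq_norm] at h
    exact pow_le_pow_left₀ infDist_nonneg h 2

theorem norm_sub_le_of_mem_bestApprox {y z w : Y} (hz : z ∈ bestApprox D F y)
    (hw : w ∈ closure (F '' D)) : ‖z - y‖ ≤ ‖w - y‖ := by
  rw [hz.2, ← dist_eq_norm, dist_comm]
  exact infDist_le_dist_of_mem hw

theorem smul_mem_closure_of_cone [NormedSpace ℝ Y]
    (hcone : ∀ y ∈ F '' D, ∀ s : ℝ, 0 < s → s • y ∈ F '' D)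
    {z : Y} (hz : z ∈ closure (F '' D)) {s : ℝ} (hs : 0 < s) : s • z ∈ closure (F '' D) :=
  map_mem_closure (continuous_const_smul s) hz fun y hy => hcone y hy s hs

theorem isCompact_unit_norm [NormedSpace ℝ Y] [FiniteDimensional ℝ Y] :
    IsCompact {y : Y | ‖y‖ = 1} := by
  have := FiniteDimensional.proper ℝ Y
  simpa [sphere, dist_zero_right] using isCompact_sphere (0 : Y) 1

theorem continuous_lossInf (hD : D.Nonempty) : Continuous (lossInf D F) := by
  rw [funext (lossInf_eq_infDist_sq (F := F) hD)]
  exact (continuous_infDist_pt _).pow 2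

theorem Theta_lt_one [NormedSpace ℝ Y] [FiniteDimensional ℝ Y] [Nontrivial Y] (hD : D.Nonempty)
    (hexpr : ∀ y : Y, y ≠ 0 → lossInf D F y < ‖y‖ ^ 2) : Theta D F < 1 := by
  obtain ⟨u, hu⟩ := exists_norm_eq Y zero_le_one
  obtain ⟨y, hy, h⟩ := isCompact_unit_norm.exists_sSup_image_eq ⟨u, hu⟩
    (continuous_lossInf (F := F) hD).continuousOn
  have hy1 : ‖y‖ = 1 := hy
  have hlt := hexpr y (norm_ne_zero_iff.1 (by simp [hy1]))
  rw [hy1, one_pow] at hlt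
  exact h.trans_lt hlt

theorem lossInf_le_Theta [NormedSpace ℝ Y] [FiniteDimensional ℝ Y] (hD : D.Nonempty)
    {y : Y} (hy : ‖y‖ = 1) : lossInf D F y ≤ Theta D F :=
  le_csSup (isCompact_unit_norm.image (continuous_lossInf hD)).bddAbove ⟨y, hy, rfl⟩

theorem infDist_sq_le_Theta_mul [NormedSpace ℝ Y] [FiniteDimensional ℝ Y] (hD : D.Nonempty)
    (hcone : ∀ y ∈ F '' D, ∀ s : ℝ, 0 < s → s • y ∈ F '' D) {y : Y} (hy : y ≠ 0) :
    infDist y (closure (F '' D)) ^ 2 ≤ Theta D F * ‖y‖ ^ 2 := by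
  have := FiniteDimensional.proper ℝ Y
  have hn : 0 < ‖y‖ := norm_pos_iff.2 hy
  obtain ⟨p, hp, hdist⟩ := isClosed_closure.exists_infDist_eq_dist
    (hD.image F).closure (‖y‖⁻¹ • y)
  have hu : ‖‖y‖⁻¹ • y‖ = 1 := by
    rw [norm_smul, norm_inv, norm_norm, inv_mul_cancel₀ hn.ne']
  have hΘ := lossInf_le_Theta (F := F) hD hu
  rw [lossInf_eq_infDist_sq hD, hdist] at hΘ
  have hle := infDist_le_dist_of_mem (x := y) (smul_mem_closure_of_cone hcone hp hn)
  have hscale : dist y (‖y‖ • p) = ‖y‖ * dist (‖y‖⁻¹ • y) p := by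
    nth_rewrite 1 [← smul_inv_smul₀ hn.ne' y]
    rw [dist_smul₀, norm_norm]
  rw [hscale] at hle
  calc infDist y (closure (F '' D)) ^ 2
      ≤ (‖y‖ * dist (‖y‖⁻¹ • y) p) ^ 2 := pow_le_pow_left₀ infDist_nonneg hle 2
    _ = dist (‖y‖⁻¹ • y) p ^ 2 * ‖y‖ ^ 2 := by ring
    _ ≤ Theta D F * ‖y‖ ^ 2 := by gcongr

/-- The residual of a best approximation in a closed cone is orthogonal to that approximation. -/
theorem inner_sub_eq_zero_of_mem_bestApprox [InnerProductSpace ℝ Y]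
    (hcone : ∀ y ∈ F '' D, ∀ s : ℝ, 0 < s → s • y ∈ F '' D)
    {y z : Y} (hz : z ∈ bestApprox D F y) : ⟪z, y - z⟫_ℝ = 0 := by
  have key : ∀ e : ℝ, -1 < e → 0 ≤ e ^ 2 * ‖z‖ ^ 2 - 2 * e * ⟪z, y - z⟫_ℝ := by
    intro e he
    have h := norm_sub_le_of_mem_bestApprox hz
      (smul_mem_closure_of_cone hcone hz.1 (s := 1 + e) (by linarith))
    have hsq := pow_le_pow_left₀ (norm_nonneg _) h 2
    have hrw : (1 + e) • z - y = e • z - (y - z) := by module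
    rw [hrw, norm_sub_sq_real (e • z), norm_smul, mul_pow, Real.norm_eq_abs, sq_abs,
      real_inner_smul_left, norm_sub_rev z y] at hsq
    linarith
  set a := ‖z‖ ^ 2
  set b := ⟪z, y - z⟫_ℝ
  have ha0 : 0 ≤ a := by positivity
  by_contra hb
  have hK : 0 < a + |b| + 1 := by positivity
  have h := key (b / (a + |b| + 1)) (by
    rw [lt_div_iff₀ hK]
    linarith [neg_abs_le b])
  have heq : (b / (a + |b| + 1)) ^ 2 * a - 2 * (b / (a + |b| + 1)) * b
      = -((b / (a + |b| + 1)) ^ 2 * (a + 2 * |b| + 2)) := by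
    field_simp
    ring
  have hpos : 0 < (b / (a + |b| + 1)) ^ 2 * (a + 2 * |b| + 2) := by positivity
  linarith

theorem abs_le_of_mem_bestApprox [InnerProductSpace ℝ Y] [FiniteDimensional ℝ Y] [Nontrivial Y]
    (hD : D.Nonempty) (hcone : ∀ y ∈ F '' D, ∀ s : ℝ, 0 < s → s • y ∈ F '' D)
    (hexpr : ∀ y : Y, y ≠ 0 → lossInf D F y < ‖y‖ ^ 2) {yd ybar : Y}
    (hyd : yd ∉ closure (F '' D)) (hybar : ybar ∈ bestApprox D F yd) {s : ℝ}
    (hs : ybar ∈ bestApprox D F (ybar + (s / ‖yd - ybar‖) • (yd - ybar))) :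
    |s| ≤ √(Theta D F / (1 - Theta D F)) * ‖ybar‖ := by
  rcases eq_or_ne s 0 with rfl | hs0
  · simpa using mul_nonneg (Real.sqrt_nonneg _) (norm_nonneg ybar)
  have hne : ‖yd - ybar‖ ≠ 0 :=
    norm_ne_zero_iff.2 (sub_ne_zero.2 fun h => hyd (h ▸ hybar.1))
  set v := (s / ‖yd - ybar‖) • (yd - ybar) with hv
  have hvs : ‖v‖ ^ 2 = s ^ 2 := by
    rw [hv, norm_smul, mul_pow, Real.norm_eq_abs, sq_abs]
    field_simp
  have horth : ⟪ybar, v⟫_ℝ = 0 := by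
    rw [hv, real_inner_smul_right, inner_sub_eq_zero_of_mem_bestApprox hcone hybar, mul_zero]
  have hnorm : ‖ybar + v‖ ^ 2 = ‖ybar‖ ^ 2 + s ^ 2 := by
    rw [norm_add_sq_real, horth, hvs]
    ring
  have hy0 : ybar + v ≠ 0 := by
    intro h
    rw [h, norm_zero] at hnorm
    have : 0 < s ^ 2 := by positivity
    nlinarith [sq_nonneg ‖ybar‖]
  have hle := infDist_sq_le_Theta_mul hD hcone hy0
  rw [← hs.2, sub_add_cancel_left, norm_neg, hvs, hnorm] at hle
  have hΘ : 0 < 1 - Theta D F := sub_pos.2 (Theta_lt_one hD hexpr)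
  have hsq : s ^ 2 ≤ Theta D F / (1 - Theta D F) * ‖ybar‖ ^ 2 := by
    rw [div_mul_eq_mul_div, le_div_iff₀ hΘ]
    linarith
  calc |s| = √(s ^ 2) := (Real.sqrt_sq_eq_abs s).symm
    _ ≤ √(Theta D F / (1 - Theta D F) * ‖ybar‖ ^ 2) := Real.sqrt_le_sqrt hsq
    _ = √(Theta D F / (1 - Theta D F)) * ‖ybar‖ := by
      rw [Real.sqrt_mul' _ (sq_nonneg _), Real.sqrt_sq (norm_nonneg _)]

end Cone

theorem no_solar_points {Y : Type} [NormedAddCommGroup Y]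
    [InnerProductSpace ℝ Y] [FiniteDimensional ℝ Y] [Nontrivial Y] {m : ℕ}
    (D : Set (Fin m → ℝ)) (hD : D.Nonempty) (F : (Fin m → ℝ) → Y)
    (hcone : ∀ y ∈ F '' D, ∀ s : ℝ, 0 < s → s • y ∈ F '' D)
    (hexpr : ∀ y : Y, y ≠ 0 → lossInf D F y < ‖y‖ ^ 2)
    (hcl : closure (F '' D) ≠ Set.univ) :
    (∀ yd : Y, yd ∉ closure (F '' D) → ∀ ybar ∈ bestApprox D F yd, ∀ s : ℝ,
      Real.sqrt (Theta D F / (1 - Theta D F)) * ‖ybar‖ < |s| →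
      ybar ∉ bestApprox D F (ybar + (s / ‖yd - ybar‖) • (yd - ybar))) ∧
    ¬ ∃ yd : Y, yd ∉ closure (F '' D) ∧ ∃ ybar ∈ bestApprox D F yd,
        ∀ s : ℝ, 0 < s → ybar ∈ bestApprox D F (ybar + s • (yd - ybar)) := by
  refine ⟨fun yd hyd ybar hybar s hlt hs =>
    (abs_le_of_mem_bestApprox hD hcone hexpr hyd hybar hs).not_gt hlt, ?_⟩
  rintro ⟨yd, hyd, ybar, hybar, h⟩
  have hpos : 0 < ‖yd - ybar‖ :=
    norm_pos_iff.2 (sub_ne_zero.2 fun h => hyd (h ▸ hybar.1))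
  have hc : 0 ≤ √(Theta D F / (1 - Theta D F)) * ‖ybar‖ := by positivity
  have hle := abs_le_of_mem_bestApprox hD hcone hexpr hyd hybar
    (h ((√(Theta D F / (1 - Theta D F)) * ‖ybar‖ + 1) / ‖yd - ybar‖) (by positivity))
  rw [abs_of_pos (by linarith)] at hle
  linarith
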